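/- Suppose (θ₀,…,θ₆) ∈ (T³)⁷ is such that among the seven first coordinates θ₀¹,…,θ₆¹ there are exactly 3 distinct values, occurring with multiplicities 3, 3, 1. Then |Θ(θ₀,…,θ₆)| ≤ 6/35. -/

import Mathlib

open scoped BigOperators
open scoped Classical

noncomputable section

instance : Fact ((0:ℝ) < 1) := ⟨one_pos⟩

/-- The circle `ℝ/ℤ` with its standard circular order. -/
abbrev S1 : Type := AddCircle (1 : ℝ)

/-- The 3-torus `S¹ × S¹ × S¹`. -/
abbrev T3 : Type := S1 × S1 × S1

/-- The orientation cocycle on the circle: `1` if `(a,b,c)` are pairwise distinct and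
positively oriented, `-1` if pairwise distinct and negatively oriented, `0` otherwise. -/
noncomputable def OrS1 (a b c : S1) : ℝ :=
  if sbtw a b c then 1 else if sbtw c b a then -1 else 0

/-- The cocycle `Θ` on `(T³)⁷`. -/
noncomputable def Theta (θ : Fin 7 → T3) : ℝ :=
  (1 / (Nat.factorial 7 : ℝ)) * ∑ σ : Equiv.Perm (Fin 7),
    ((Equiv.Perm.sign σ : ℤ) : ℝ) *
      (OrS1 (θ (σ 0)).1 (θ (σ 1)).1 (θ (σ 2)).1 *
       OrS1 (θ (σ 2)).2.1 (θ (σ 3)).2.1 (θ (σ 4)).2.1 *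
       OrS1 (θ (σ 4)).2.2 (θ (σ 5)).2.2 (θ (σ 6)).2.2)

section OrientationCocycle

lemma OrS1_swap_right (a b c : S1) : OrS1 a c b = -OrS1 a b c := by
  have h₁ : sbtw a c b ↔ sbtw c b a := sbtw_cyclic.symm
  have h₂ : sbtw b c a ↔ sbtw a b c := sbtw_cyclic
  have h₃ : sbtw a b c → ¬ sbtw c b a := fun h => h.not_sbtw
  simp only [OrS1, h₁, h₂]
  split_ifs <;> first | (exfalso; tauto) | norm_num

lemma OrS1_rotate (a b c : S1) : OrS1 b c a = OrS1 a b c := by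
  have h₁ : sbtw b c a ↔ sbtw a b c := sbtw_cyclic
  have h₂ : sbtw a c b ↔ sbtw c b a := sbtw_cyclic.symm
  simp only [OrS1, h₁, h₂]

lemma OrS1_swap_left (a b c : S1) : OrS1 b a c = -OrS1 a b c := by
  rw [← OrS1_rotate, OrS1_swap_right]

lemma abs_OrS1_le_one (a b c : S1) : |OrS1 a b c| ≤ 1 := by
  unfold OrS1
  split_ifs <;> norm_num

lemma OrS1_eq_zero_of_left_eq (a c : S1) : OrS1 a a c = 0 := by
  linarith [OrS1_swap_left a a c]

lemma OrS1_eq_zero_of_right_eq (a c : S1) : OrS1 a c c = 0 := by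
  linarith [OrS1_swap_right a c c]

lemma OrS1_eq_zero_of_outer_eq (a b : S1) : OrS1 a b a = 0 := by
  rw [← OrS1_rotate, OrS1_eq_zero_of_right_eq]

end OrientationCocycle

lemma sum_abs_sub_le_eight {u₀ u₁ u₂ u₃ : ℝ} (h₀ : |u₀| ≤ 1) (h₁ : |u₁| ≤ 1) (h₂ : |u₂| ≤ 1)
    (h₃ : |u₃| ≤ 1) :
    |u₀ - u₁| + |u₀ - u₂| + |u₀ - u₃| + |u₁ - u₂| + |u₁ - u₃| + |u₂ - u₃| ≤ 8 := by
  rw [abs_le] at *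
  obtain ⟨_, _⟩ := h₀
  obtain ⟨_, _⟩ := h₁
  obtain ⟨_, _⟩ := h₂
  obtain ⟨_, _⟩ := h₃
  rcases abs_cases (u₀ - u₁) with ⟨e₁, _⟩ | ⟨e₁, _⟩ <;>
  rcases abs_cases (u₀ - u₂) with ⟨e₂, _⟩ | ⟨e₂, _⟩ <;>
  rcases abs_cases (u₀ - u₃) with ⟨e₃, _⟩ | ⟨e₃, _⟩ <;>
  rcases abs_cases (u₁ - u₂) with ⟨e₄, _⟩ | ⟨e₄, _⟩ <;>
  rcases abs_cases (u₁ - u₃) with ⟨e₅, _⟩ | ⟨e₅, _⟩ <;>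
  rcases abs_cases (u₂ - u₃) with ⟨e₆, _⟩ | ⟨e₆, _⟩ <;>
  linarith

lemma sum_sign_mul_perm_four (F : Fin 4 → Fin 4 → Fin 4 → Fin 4 → ℝ) :
    ∑ τ : Equiv.Perm (Fin 4), ((Equiv.Perm.sign τ : ℤ) : ℝ) * F (τ 0) (τ 1) (τ 2) (τ 3) =
      F 0 1 2 3 - F 0 1 3 2 - F 0 2 1 3 + F 0 2 3 1 - F 0 3 2 1 + F 0 3 1 2 -
      F 1 0 2 3 + F 1 0 3 2 + F 1 2 0 3 - F 1 2 3 0 + F 1 3 2 0 - F 1 3 0 2 -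
      F 2 1 0 3 + F 2 1 3 0 + F 2 0 1 3 - F 2 0 3 1 + F 2 3 0 1 - F 2 3 1 0 -
      F 3 1 2 0 + F 3 1 0 2 + F 3 2 1 0 - F 3 2 0 1 + F 3 0 2 1 - F 3 0 1 2 := by
  have h₁ : (1 : Fin 4) = Fin.succ 0 := rfl
  have h₂ : (2 : Fin 4) = Fin.succ 1 := rfl
  have h₃ : (3 : Fin 4) = Fin.succ 2 := rfl
  have h₄ : (1 : Fin 3) = Fin.succ 0 := rfl
  have h₅ : (2 : Fin 3) = Fin.succ 1 := rfl
  have h₆ : (1 : Fin 2) = Fin.succ 0 := rfl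
  rw [h₁, h₂, h₃, Finset.univ_perm_fin_succ, ← Finset.univ_product_univ]
  simp only [Finset.sum_map, Finset.sum_product, Equiv.toEmbedding_apply,
    Equiv.Perm.decomposeFin_symm_apply_zero, Equiv.Perm.decomposeFin_symm_apply_succ,
    Equiv.Perm.decomposeFin.symm_sign, h₄, h₅]
  rw [Finset.univ_perm_fin_succ, ← Finset.univ_product_univ]
  simp only [Finset.sum_map, Finset.sum_product, Equiv.toEmbedding_apply,
    Equiv.Perm.decomposeFin_symm_apply_zero, Equiv.Perm.decomposeFin_symm_apply_succ,
    Equiv.Perm.decomposeFin.symm_sign, h₆]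
  rw [Finset.univ_perm_fin_succ, ← Finset.univ_product_univ]
  simp only [Finset.sum_map, Finset.sum_product, Equiv.toEmbedding_apply,
    Equiv.Perm.decomposeFin_symm_apply_zero, Equiv.Perm.decomposeFin_symm_apply_succ,
    Equiv.Perm.decomposeFin.symm_sign]
  simp [Fin.sum_univ_four, Fin.sum_univ_three, Fin.sum_univ_two, Equiv.swap_apply_def]
  ring

/-- The alternating sum over four points of the product of an antisymmetric kernel and an
alternating kernel, both bounded by `1`, is at most `16` in absolute value. -/
lemma abs_alternating_sum_four_le {m : Fin 4 → Fin 4 → ℝ} {h : Fin 4 → Fin 4 → Fin 4 → ℝ}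
    (hm : ∀ x y, |m x y| ≤ 1) (hm_swap : ∀ x y, m y x = -m x y)
    (hh : ∀ x y z, |h x y z| ≤ 1) (hh_left : ∀ x y z, h y x z = -h x y z)
    (hh_right : ∀ x y z, h x z y = -h x y z) :
    |∑ τ : Equiv.Perm (Fin 4), ((Equiv.Perm.sign τ : ℤ) : ℝ) *
      (m (τ 0) (τ 1) * h (τ 1) (τ 2) (τ 3))| ≤ 16 := by
  have bound : ∀ i j u, m i j * u ≤ |u| ∧ -|u| ≤ m i j * u := fun i j u => by
    have : |m i j * u| ≤ |u| := by
      rw [abs_mul]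
      exact mul_le_of_le_one_left (abs_nonneg u) (hm i j)
    exact (abs_le.mp this).symm
  have key : ∑ τ : Equiv.Perm (Fin 4), ((Equiv.Perm.sign τ : ℤ) : ℝ) *
      (m (τ 0) (τ 1) * h (τ 1) (τ 2) (τ 3)) =
      2 * (m 0 1 * (h 1 2 3 - -h 0 2 3) + m 0 2 * (h 1 2 3 - h 0 1 3) +
        m 0 3 * (h 1 2 3 - -h 0 1 2) + m 1 2 * (-h 0 2 3 - h 0 1 3) +
        m 1 3 * (-h 0 2 3 - -h 0 1 2) + m 2 3 * (h 0 1 3 - -h 0 1 2)) := by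
    have hh_rotate : ∀ x y z, h y z x = h x y z := fun x y z => by
      rw [hh_right, hh_left, neg_neg]
    rw [sum_sign_mul_perm_four fun x y z w => m x y * h y z w]
    simp only [hm_swap 0 1, hm_swap 0 2, hm_swap 0 3, hm_swap 1 2, hm_swap 1 3, hm_swap 2 3,
      hh_rotate 0 1 2, hh_rotate 0 1 3, hh_rotate 0 2 3, hh_rotate 1 2 3,
      ← hh_rotate 2 0 1, ← hh_rotate 3 0 1, ← hh_rotate 3 0 2, ← hh_rotate 3 1 2,
      hh_right 0 1 2, hh_right 0 1 3, hh_right 0 2 3, hh_right 1 2 3,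
      hh_left 0 1 2, hh_left 0 1 3, hh_left 0 2 3, hh_left 1 2 3,
      hh_rotate 0 2 1, hh_rotate 0 3 1, hh_rotate 0 3 2, hh_rotate 1 3 2]
    ring
  have hu := sum_abs_sub_le_eight (hh 1 2 3) ((abs_neg _).trans_le (hh 0 2 3)) (hh 0 1 3)
    ((abs_neg _).trans_le (hh 0 1 2))
  rw [key, abs_le]
  constructor <;>
  linarith [bound 0 1 (h 1 2 3 - -h 0 2 3), bound 0 2 (h 1 2 3 - h 0 1 3),
    bound 0 3 (h 1 2 3 - -h 0 1 2), bound 1 2 (-h 0 2 3 - h 0 1 3),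
    bound 1 3 (-h 0 2 3 - -h 0 1 2), bound 2 3 (h 0 1 3 - -h 0 1 2)]

/-- Averaging over the symmetric group of the images of a fixed embedding. -/
lemma card_embedding_mul_sum_perm {α ι : Type*} [Fintype α] [DecidableEq α] [Fintype ι]
    (F : (ι ↪ α) → ℝ) (e₀ : ι ↪ α) :
    (Fintype.card (ι ↪ α) : ℝ) * ∑ σ : Equiv.Perm α, F (e₀.trans σ.toEmbedding) =
      (Fintype.card (Equiv.Perm α) : ℝ) * ∑ e, F e := by
  have h₁ : ∀ e : ι ↪ α, ∑ σ : Equiv.Perm α, F (e.trans σ.toEmbedding) =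
      ∑ σ : Equiv.Perm α, F (e₀.trans σ.toEmbedding) := by
    intro e
    obtain ⟨ρ, hρ⟩ : ∃ ρ : Equiv.Perm α, e₀.trans ρ.toEmbedding = e := by
      have := Equiv.Perm.isMultiplyPretransitive α (Fintype.card ι)
      let c := Fintype.equivFin ι
      obtain ⟨ρ, hρ⟩ := MulAction.exists_smul_eq (Equiv.Perm α)
        (c.symm.toEmbedding.trans e₀) (c.symm.toEmbedding.trans e)
      refine ⟨ρ, ?_⟩
      ext i
      simpa using DFunLike.congr_fun hρ (c i)
    subst hρ
    exact Fintype.sum_equiv (Equiv.mulRight ρ) _ _ fun σ => rfl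
  have h₂ : ∀ σ : Equiv.Perm α, ∑ e : ι ↪ α, F (e.trans σ.toEmbedding) = ∑ e, F e := by
    intro σ
    exact Fintype.sum_equiv (Equiv.embeddingCongr (Equiv.refl ι) σ) _ _ fun e => by
      congr 1
  calc _ = ∑ e : ι ↪ α, ∑ σ : Equiv.Perm α, F (e.trans σ.toEmbedding) := by
        simp [h₁]
    _ = _ := by
        rw [Finset.sum_comm]
        simp [h₂]


lemma abs_sum_perm_seven_le (f g h : Fin 7 → Fin 7 → Fin 7 → ℝ)
    (hg : ∀ x y z, |g x y z| ≤ 1) (hg_right : ∀ x y z, g x z y = -g x y z)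
    (hh : ∀ x y z, |h x y z| ≤ 1) (hh_left : ∀ x y z, h y x z = -h x y z)
    (hh_right : ∀ x y z, h x z y = -h x y z) :
    24 * |∑ σ : Equiv.Perm (Fin 7), ((Equiv.Perm.sign σ : ℤ) : ℝ) *
      (f (σ 0) (σ 1) (σ 2) * g (σ 2) (σ 3) (σ 4) * h (σ 4) (σ 5) (σ 6))| ≤
      16 * ∑ σ : Equiv.Perm (Fin 7), |f (σ 0) (σ 1) (σ 2)| := by
  set T : Equiv.Perm (Fin 7) → ℝ := fun σ => ((Equiv.Perm.sign σ : ℤ) : ℝ) *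
      (f (σ 0) (σ 1) (σ 2) * g (σ 2) (σ 3) (σ 4) * h (σ 4) (σ 5) (σ 6)) with hT
  let ι : Fin 4 ↪ Fin 7 := ⟨Fin.natAdd 3, Fin.natAdd_injective 4 3⟩
  let E : Equiv.Perm (Fin 4) → Equiv.Perm (Fin 7) := fun τ => τ.viaFintypeEmbedding ι
  have hE_low : ∀ τ (i : Fin 7), i < 3 → E τ i = i := fun τ i hi =>
    Equiv.Perm.viaFintypeEmbedding_apply_notMem_range _ _ (by
      rintro ⟨j, rfl⟩
      simp [ι, Fin.lt_def] at hi)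
  have hE_high : ∀ τ j, E τ (ι j) = ι (τ j) := fun τ j =>
    Equiv.Perm.viaFintypeEmbedding_apply_image _ _ _
  have inner : ∀ σ, ∑ τ, T (σ * E τ) = ((Equiv.Perm.sign σ : ℤ) : ℝ) * f (σ 0) (σ 1) (σ 2) *
      ∑ τ : Equiv.Perm (Fin 4), ((Equiv.Perm.sign τ : ℤ) : ℝ) *
        (g (σ 2) (σ (ι (τ 0))) (σ (ι (τ 1))) *
          h (σ (ι (τ 1))) (σ (ι (τ 2))) (σ (ι (τ 3)))) := by
    intro σ
    rw [Finset.mul_sum]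
    refine Finset.sum_congr rfl fun τ _ => ?_
    have h3 : E τ 3 = ι (τ 0) := hE_high τ 0
    have h4 : E τ 4 = ι (τ 1) := hE_high τ 1
    have h5 : E τ 5 = ι (τ 2) := hE_high τ 2
    have h6 : E τ 6 = ι (τ 3) := hE_high τ 3
    have hs : Equiv.Perm.sign (E τ) = Equiv.Perm.sign τ := Equiv.Perm.viaFintypeEmbedding_sign _ _
    simp only [hT, Equiv.Perm.mul_apply, h3, h4, h5, h6, hE_low τ 0 (by decide),
      hE_low τ 1 (by decide), hE_low τ 2 (by decide), Equiv.Perm.sign_mul, hs]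
    push_cast
    ring
  have average : 24 * ∑ σ, T σ = ∑ σ, ∑ τ, T (σ * E τ) := by
    rw [Finset.sum_comm]
    have : ∀ τ, ∑ σ, T (σ * E τ) = ∑ σ, T σ := fun τ =>
      Fintype.sum_equiv (Equiv.mulRight (E τ)) _ _ fun _ => rfl
    simp [this, Fintype.card_perm, Nat.factorial]
  calc 24 * |∑ σ, T σ| = |∑ σ, ∑ τ, T (σ * E τ)| := by
        rw [← average, abs_mul]
        norm_num
    _ ≤ ∑ σ, |∑ τ, T (σ * E τ)| := Finset.abs_sum_le_sum_abs _ _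
    _ ≤ ∑ σ : Equiv.Perm (Fin 7), 16 * |f (σ 0) (σ 1) (σ 2)| := by
        refine Finset.sum_le_sum fun σ _ => ?_
        have sign_abs : |((Equiv.Perm.sign σ : ℤ) : ℝ)| = 1 := by
          rcases Int.units_eq_one_or (Equiv.Perm.sign σ) with h | h <;> simp [h]
        rw [inner, abs_mul, abs_mul, sign_abs, one_mul, mul_comm]
        refine mul_le_mul_of_nonneg_right ?_ (abs_nonneg _)
        exact abs_alternating_sum_four_le
          (m := fun x y => g (σ 2) (σ (ι x)) (σ (ι y)))
          (h := fun x y z => h (σ (ι x)) (σ (ι y)) (σ (ι z)))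
          (fun _ _ => hg _ _ _) (fun _ _ => hg_right _ _ _)
          (fun _ _ _ => hh _ _ _) (fun _ _ _ => hh_left _ _ _) (fun _ _ _ => hh_right _ _ _)
    _ = _ := (Finset.mul_sum _ _ _).symm

lemma sum_perm_le_of_sum_triple_le {f : Fin 7 → Fin 7 → Fin 7 → ℝ} (hf : ∀ i j k, 0 ≤ f i j k) :
    ∑ σ : Equiv.Perm (Fin 7), f (σ 0) (σ 1) (σ 2) ≤ 24 * ∑ i, ∑ j, ∑ k, f i j k := by
  have h := card_embedding_mul_sum_perm
    (fun e : Fin 3 ↪ Fin 7 => f (e 0) (e 1) (e 2)) (Fin.castLEEmb (by norm_num : 3 ≤ 7))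
  have inj : Function.Injective fun e : Fin 3 ↪ Fin 7 => (e 0, e 1, e 2) := by
    intro e e' he
    simp only [Prod.mk.injEq] at he
    ext i
    fin_cases i <;> simp [he]
  have hle : ∑ e : Fin 3 ↪ Fin 7, f (e 0) (e 1) (e 2) ≤ ∑ i, ∑ j, ∑ k, f i j k := by
    simp_rw [← Fintype.sum_prod_type']
    calc _ = ∑ p ∈ Finset.univ.map ⟨_, inj⟩, f p.1 p.2.1 p.2.2 := by simp
      _ ≤ _ := Finset.sum_le_sum_of_subset_of_nonneg (Finset.subset_univ _)
        fun _ _ _ => hf _ _ _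
  have e0 : Fin.castLEEmb (by norm_num : 3 ≤ 7) 0 = 0 := rfl
  have e1 : Fin.castLEEmb (by norm_num : 3 ≤ 7) 1 = 1 := rfl
  have e2 : Fin.castLEEmb (by norm_num : 3 ≤ 7) 2 = 2 := rfl
  simp [Fintype.card_embedding_eq, Fintype.card_perm, Nat.factorial, Nat.descFactorial,
    e0, e1, e2] at h
  linarith

lemma sum_abs_OrS1_le (φ : Fin 7 → S1) (a b c : S1)
    (hab : a ≠ b) (hac : a ≠ c) (hbc : b ≠ c)
    (ha : ({j : Fin 7 | φ j = a}).ncard = 3)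
    (hb : ({j : Fin 7 | φ j = b}).ncard = 3)
    (hc : ({j : Fin 7 | φ j = c}).ncard = 1) :
    ∑ i, ∑ j, ∑ k, |OrS1 (φ i) (φ j) (φ k)| ≤ 54 := by
  let δ : S1 → Fin 7 → ℝ := fun x i => if φ i = x then 1 else 0
  have hδ : ∀ x, ∑ i, δ x i = ({j : Fin 7 | φ j = x}).ncard := fun x => by
    rw [Set.ncard_eq_toFinset_card']
    simp [δ]
  have δa : ∑ i, δ a i = 3 := by rw [hδ, ha]; norm_num
  have δb : ∑ i, δ b i = 3 := by rw [hδ, hb]; norm_num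
  have δc : ∑ i, δ c i = 1 := by rw [hδ, hc]; norm_num
  have exhaust : ∀ i, φ i = a ∨ φ i = b ∨ φ i = c := by
    have hle : ∀ i, δ a i + δ b i + δ c i ≤ 1 := fun i => by
      simp only [δ]
      split_ifs <;> first | (exfalso; simp_all; done) | norm_num
    have hsum : ∑ i, (δ a i + δ b i + δ c i) = ∑ i : Fin 7, (1 : ℝ) := by
      rw [Finset.sum_add_distrib, Finset.sum_add_distrib, δa, δb, δc]
      norm_num
    intro i
    have hi := (Finset.sum_eq_sum_iff_of_le fun i _ => hle i).mp hsum i (Finset.mem_univ i)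
    by_contra! hne
    simp [δ, hne] at hi
  have product : ∀ x y z, ∑ i, ∑ j, ∑ k, δ x i * δ y j * δ z k =
      (∑ i, δ x i) * (∑ j, δ y j) * ∑ k, δ z k := fun x y z => by
    simp only [← Finset.mul_sum, ← Finset.sum_mul]
  calc ∑ i, ∑ j, ∑ k, |OrS1 (φ i) (φ j) (φ k)|
      ≤ ∑ i, ∑ j, ∑ k, (δ a i * δ b j * δ c k + δ a i * δ c j * δ b k + δ b i * δ a j * δ c k +
          δ b i * δ c j * δ a k + δ c i * δ a j * δ b k + δ c i * δ b j * δ a k) := by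
        refine Finset.sum_le_sum fun i _ => Finset.sum_le_sum fun j _ =>
          Finset.sum_le_sum fun k _ => ?_
        rcases exhaust i with hi | hi | hi <;> rcases exhaust j with hj | hj | hj <;>
          rcases exhaust k with hk | hk | hk <;>
          simp [δ, hi, hj, hk, hab, hac, hbc, hab.symm, hac.symm, hbc.symm, abs_OrS1_le_one,
            OrS1_eq_zero_of_left_eq, OrS1_eq_zero_of_right_eq, OrS1_eq_zero_of_outer_eq]
    _ = 54 := by
        simp only [Finset.sum_add_distrib, product, δa, δb, δc]
        norm_num

/-- If the seven first coordinates take exactly 3 distinct values with multiplicities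
`3, 3, 1`, then `|Θ(θ₀,…,θ₆)| ≤ 6/35`. -/
theorem abs_Theta_le_of_mult_331 (θ : Fin 7 → T3) (a b c : S1)
    (hab : a ≠ b) (hac : a ≠ c) (hbc : b ≠ c)
    (ha : ({j : Fin 7 | (θ j).1 = a}).ncard = 3)
    (hb : ({j : Fin 7 | (θ j).1 = b}).ncard = 3)
    (hc : ({j : Fin 7 | (θ j).1 = c}).ncard = 1) :
    |Theta θ| ≤ 6 / 35 := by
  have h₁ := abs_sum_perm_seven_le (fun i j k => OrS1 (θ i).1 (θ j).1 (θ k).1)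
    (fun i j k => OrS1 (θ i).2.1 (θ j).2.1 (θ k).2.1)
    (fun i j k => OrS1 (θ i).2.2 (θ j).2.2 (θ k).2.2)
    (fun _ _ _ => abs_OrS1_le_one _ _ _) (fun _ _ _ => OrS1_swap_right _ _ _)
    (fun _ _ _ => abs_OrS1_le_one _ _ _) (fun _ _ _ => OrS1_swap_left _ _ _)
    (fun _ _ _ => OrS1_swap_right _ _ _)
  have h₂ := sum_perm_le_of_sum_triple_le
    (f := fun i j k => |OrS1 (θ i).1 (θ j).1 (θ k).1|) fun _ _ _ => abs_nonneg _
  have h₃ := sum_abs_OrS1_le (fun i => (θ i).1) a b c hab hac hbc ha hb hc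
  rw [Theta, abs_mul, abs_of_nonneg (by positivity)]
  norm_num [Nat.factorial]
  linarith
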